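/- Let G be a finitely generated non-nilpotent meta-Nil-Hamiltonian group which has a nilpotent subgroup of finite index. Then G is soluble and the commutator subgroup G' of G is finite. -/

import Mathlib

/-- A group is *minimal non-nilpotent* if it is not nilpotent but every proper
subgroup of it is nilpotent. -/
def MinimalNonNilpotent (G : Type*) [Group G] : Prop :=
  ¬ Group.IsNilpotent G ∧ ∀ H : Subgroup G, H ≠ ⊤ → Group.IsNilpotent H

/-- A group is *biminimal non-nilpotent* if it is neither nilpotent nor minimal
non-nilpotent, but every proper subgroup of it is nilpotent or minimal non-nilpotent. -/
def BiminimalNonNilpotent (G : Type*) [Group G] : Prop :=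
  ¬ Group.IsNilpotent G ∧ ¬ MinimalNonNilpotent G ∧
    ∀ H : Subgroup G, H ≠ ⊤ → (Group.IsNilpotent H ∨ MinimalNonNilpotent H)

/-- A group is *para-Nil-Hamiltonian* if it is not nilpotent and every non-normal
subgroup of it is either nilpotent or minimal non-nilpotent. -/
def ParaNilHamiltonian (G : Type*) [Group G] : Prop :=
  ¬ Group.IsNilpotent G ∧
    ∀ H : Subgroup G, ¬ H.Normal → (Group.IsNilpotent H ∨ MinimalNonNilpotent H)

/-- A group is *meta-Nil-Hamiltonian* if every non-nilpotent subgroup of it is normal. -/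
def MetaNilHamiltonian (G : Type*) [Group G] : Prop :=
  ∀ H : Subgroup G, ¬ Group.IsNilpotent H → H.Normal

/-- A group is *locally graded* if every non-trivial finitely generated subgroup of it
contains a proper subgroup of finite index. -/
def LocallyGraded (G : Type*) [Group G] : Prop :=
  ∀ H : Subgroup G, H ≠ ⊥ → Group.FG H → ∃ K : Subgroup H, K ≠ ⊤ ∧ K.FiniteIndex

/-- A group is abelian if its multiplication commutes. -/
def Abelian (G : Type*) [Group G] : Prop := ∀ a b : G, a * b = b * a

/-- A group is *minimal non-abelian* if it is not abelian but every proper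
subgroup of it is abelian. -/
def MinimalNonAbelian (G : Type*) [Group G] : Prop :=
  ¬ Abelian G ∧ ∀ H : Subgroup G, H ≠ ⊤ → Abelian H

/-- A group is *biminimal non-abelian* if it is neither abelian nor minimal non-abelian,
but every proper subgroup of it is abelian or minimal non-abelian. -/
def BiminimalNonAbelian (G : Type*) [Group G] : Prop :=
  ¬ Abelian G ∧ ¬ MinimalNonAbelian G ∧
    ∀ H : Subgroup G, H ≠ ⊤ → (Abelian H ∨ MinimalNonAbelian H)

/-- A group is *parahamiltonian* if it is not abelian and every non-normal subgroup
of it is either abelian or minimal non-abelian. -/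
def Parahamiltonian (G : Type*) [Group G] : Prop :=
  ¬ Abelian G ∧ ∀ H : Subgroup G, ¬ H.Normal → (Abelian H ∨ MinimalNonAbelian H)

/-- A group is *locally nilpotent* if every finitely generated subgroup of it is nilpotent. -/
def LocallyNilpotent (G : Type*) [Group G] : Prop :=
  ∀ H : Subgroup G, Group.FG H → Group.IsNilpotent H

section

open Subgroup
open scoped commutatorElement Pointwise

theorem wellFoundedGT_subgroup_of_injective {G H : Type*} [Group G] [Group H]
    [WellFoundedGT (Subgroup H)] (f : G →* H) (hf : Function.Injective f) :
    WellFoundedGT (Subgroup G) :=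
  (Monotone.strictMono_of_injective (fun _ _ h => Subgroup.map_mono h)
    (Subgroup.map_injective hf)).wellFoundedGT

theorem wellFoundedGT_subgroup_of_surjective {G H : Type*} [Group G] [Group H]
    [WellFoundedGT (Subgroup G)] (f : G →* H) (hf : Function.Surjective f) :
    WellFoundedGT (Subgroup H) :=
  (Monotone.strictMono_of_injective (fun _ _ h => Subgroup.comap_mono h)
    (Subgroup.comap_injective hf)).wellFoundedGT

instance Subgroup.wellFoundedGT_subgroup {G : Type*} [Group G] [WellFoundedGT (Subgroup G)]
    (H : Subgroup G) : WellFoundedGT (Subgroup H) :=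
  wellFoundedGT_subgroup_of_injective H.subtype H.subtype_injective

instance QuotientGroup.wellFoundedGT_subgroup {G : Type*} [Group G] [WellFoundedGT (Subgroup G)]
    (N : Subgroup G) [N.Normal] : WellFoundedGT (Subgroup (G ⧸ N)) :=
  wellFoundedGT_subgroup_of_surjective (QuotientGroup.mk' N) (QuotientGroup.mk'_surjective N)

theorem wellFoundedGT_subgroup_of_extension {G : Type*} [Group G] (N : Subgroup G) [N.Normal]
    [WellFoundedGT (Subgroup N)] [WellFoundedGT (Subgroup (G ⧸ N))] :
    WellFoundedGT (Subgroup G) := by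
  have hmono : StrictMono fun S : Subgroup G =>
      (S.subgroupOf N, S.map (QuotientGroup.mk' N)) := by
    intro A B hAB
    refine lt_of_le_of_ne ⟨Subgroup.comap_mono hAB.le, Subgroup.map_mono hAB.le⟩ fun h => ?_
    obtain ⟨h₁, h₂⟩ : A.subgroupOf N = B.subgroupOf N ∧
        A.map (QuotientGroup.mk' N) = B.map (QuotientGroup.mk' N) := Prod.ext_iff.1 h
    refine hAB.not_ge fun x hx => ?_
    have hx' : (x : G ⧸ N) ∈ A.map (QuotientGroup.mk' N) := by
      have : (x : G ⧸ N) ∈ B.map (QuotientGroup.mk' N) := Subgroup.mem_map_of_mem _ hx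
      exact h₂ ▸ this
    obtain ⟨a, ha, hax⟩ := hx'
    have hN : a⁻¹ * x ∈ N := QuotientGroup.eq.1 hax
    have hB : (⟨a⁻¹ * x, hN⟩ : N) ∈ B.subgroupOf N :=
      B.mul_mem (B.inv_mem (hAB.le ha)) hx
    have hA : (⟨a⁻¹ * x, hN⟩ : N) ∈ A.subgroupOf N := h₁ ▸ hB
    simpa using A.mul_mem ha (Subgroup.mem_subgroupOf.1 hA)
  exact hmono.wellFoundedGT

theorem Subgroup.fg_of_wellFoundedGT {G : Type*} [Group G] [WellFoundedGT (Subgroup G)]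
    (S : Subgroup G) : S.FG := by
  obtain ⟨T, ⟨hT, hTS⟩, hmax⟩ := WellFounded.has_min (wellFounded_gt (α := Subgroup G))
    {T | T.FG ∧ T ≤ S} ⟨⊥, Subgroup.FG.bot, bot_le⟩
  suffices h : S ≤ T by rwa [le_antisymm h hTS]
  intro x hx
  by_contra hxT
  refine hmax (T ⊔ zpowers x)
    ⟨hT.sup ⟨{x}, by simp [Subgroup.zpowers_eq_closure]⟩,
      sup_le hTS (by simpa using hx)⟩ ?_
  refine lt_of_le_of_ne le_sup_left fun h => hxT ?_
  rw [h]
  exact (le_sup_right : zpowers x ≤ T ⊔ zpowers x) (mem_zpowers x)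

instance Subgroup.group_fg_of_wellFoundedGT {G : Type*} [Group G] [WellFoundedGT (Subgroup G)]
    (S : Subgroup G) : Group.FG S :=
  (Group.fg_iff_subgroup_fg S).2 S.fg_of_wellFoundedGT

theorem CommGroup.wellFoundedGT_subgroup_of_fg {A : Type*} [CommGroup A] [Group.FG A] :
    WellFoundedGT (Subgroup A) := by
  have : Module.Finite ℤ (Additive A) := Module.Finite.iff_addGroup_fg.2 inferInstance
  have : IsNoetherian ℤ (Additive A) := inferInstance
  have h : WellFoundedGT (Submodule ℤ (Additive A)) := inferInstance
  exact ((Subgroup.toAddSubgroup (G := A)).trans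
    AddSubgroup.toIntSubmodule).strictMono.wellFoundedGT

open Group in
theorem Group.wellFoundedGT_subgroup_of_lowerCentralSeries_eq_bot (n : ℕ) :
    ∀ (G : Type*) [Group G] [Group.FG G],
      (⊤ : Subgroup G).lowerCentralSeries n = ⊥ → WellFoundedGT (Subgroup G) := by
  induction n with
  | zero =>
    intro G _ _ h
    have : Subsingleton (Subgroup G) := subsingleton_of_bot_eq_top h.symm
    infer_instance
  | succ n ih =>
    intro G _ _ h
    set N := (⊤ : Subgroup G).lowerCentralSeries n with hN
    have hNc : N ≤ center G := commutator_top_right_eq_bot_iff_le_center.1 h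
    have hq : WellFoundedGT (Subgroup (G ⧸ N)) := by
      apply ih
      rw [← MonoidHom.range_eq_top.2 (QuotientGroup.mk'_surjective N), MonoidHom.range_eq_map,
        ← map_lowerCentralSeries, ← hN, Subgroup.map_eq_bot_iff, QuotientGroup.ker_mk']
    have hcomm : IsMulCommutative N :=
      ⟨⟨fun a b => Subtype.ext (mem_center_iff.1 (hNc b.2) a)⟩⟩
    have hfg : N.FG := by
      cases n with
      | zero => exact Group.fg_def.1 inferInstance
      | succ k =>
        set P := (⊤ : Subgroup G).lowerCentralSeries k with hP
        obtain ⟨U, hU⟩ := (P.map (QuotientGroup.mk' N)).fg_of_wellFoundedGT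
        obtain ⟨S, hS⟩ := Group.fg_def.1 (inferInstance : Group.FG G)
        choose! u huP hu using fun x : G ⧸ N => fun hx : x ∈ P.map (QuotientGroup.mk' N) => hx
        have hUP : ∀ x ∈ U, x ∈ P.map (QuotientGroup.mk' N) := fun x hx => hU ▸ subset_closure hx
        set T : Set G := (fun z : (G ⧸ N) × G => ⁅u z.1, z.2⁆) '' (↑U ×ˢ ↑S) with hT
        have hTN : T ⊆ N := by
          rintro _ ⟨⟨x, s⟩, ⟨hx, -⟩, rfl⟩
          exact commutator_mem_commutator (huP x (hUP x hx)) (mem_top s)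
        have hMN : closure T ≤ N := (closure_le N).2 hTN
        have hMn : (closure T).Normal :=
          ⟨fun x hx g => by
            rwa [mem_center_iff.1 (hNc (hMN hx)) g, mul_inv_cancel_right]⟩
        suffices h : N ≤ closure T by
          rw [le_antisymm h hMN]
          exact (Subgroup.fg_iff _).2 ⟨T, rfl, (U.finite_toSet.prod S.finite_toSet).image _⟩
        have hcen : ∀ y, y ∈ (center (G ⧸ closure T)).comap (QuotientGroup.mk' (closure T)) ↔
            ∀ g, ⁅y, g⁆ ∈ closure T := by
          intro y
          rw [mem_comap, mem_center_iff, (QuotientGroup.mk'_surjective (closure T)).forall]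
          refine forall_congr' fun g => ?_
          rw [← QuotientGroup.eq_one_iff, ← QuotientGroup.mk'_apply, map_commutatorElement,
            commutatorElement_eq_one_iff_mul_comm, eq_comm]
        have hNcen : N ≤ (center (G ⧸ closure T)).comap (QuotientGroup.mk' (closure T)) :=
          fun y hy => (hcen y).2 fun g => by
            rw [commutatorElement_eq_one_iff_mul_comm.2 (mem_center_iff.1 (hNc hy) g).symm]
            exact one_mem _
        have hucen : ∀ x ∈ U,
            u x ∈ (center (G ⧸ closure T)).comap (QuotientGroup.mk' (closure T)) := by
          intro x hx
          rw [hcen]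
          have hle : (⊤ : Subgroup G) ≤ (centralizer {(QuotientGroup.mk' (closure T)) (u x)}).comap
              (QuotientGroup.mk' (closure T)) := by
            rw [← hS, closure_le]
            intro s hs
            rw [SetLike.mem_coe, mem_comap, mem_centralizer_singleton_iff,
              eq_comm, ← commutatorElement_eq_one_iff_mul_comm, ← map_commutatorElement,
              QuotientGroup.mk'_apply, QuotientGroup.eq_one_iff]
            exact subset_closure ⟨(x, s), ⟨hx, hs⟩, rfl⟩
          intro g
          have hg := hle (mem_top g)
          rwa [mem_comap, mem_centralizer_singleton_iff,
              eq_comm, ← commutatorElement_eq_one_iff_mul_comm, ← map_commutatorElement,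
              QuotientGroup.mk'_apply, QuotientGroup.eq_one_iff] at hg
        have hPcen : P ≤ (center (G ⧸ closure T)).comap (QuotientGroup.mk' (closure T)) := by
          have hle : P.map (QuotientGroup.mk' N) ≤
              ((center (G ⧸ closure T)).comap (QuotientGroup.mk' (closure T))).map
                (QuotientGroup.mk' N) := by
            rw [← hU, closure_le]
            intro x hx
            exact ⟨u x, hucen x hx, hu x (hUP x hx)⟩
          rwa [Subgroup.map_le_map_iff, QuotientGroup.ker_mk', sup_eq_left.2 hNcen] at hle
        rw [hN, Subgroup.lowerCentralSeries_succ, ← hP]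
        exact commutator_le.2 fun p hp g _ => (hcen p).1 (hPcen hp) g
    have : Group.FG N := (Group.fg_iff_subgroup_fg N).2 hfg
    have : WellFoundedGT (Subgroup N) := by
      let _ : CommGroup N := { (inferInstance : Group N) with mul_comm := hcomm.is_comm.comm }
      exact CommGroup.wellFoundedGT_subgroup_of_fg
    exact wellFoundedGT_subgroup_of_extension N

theorem Group.wellFoundedGT_subgroup_of_fg_of_isNilpotent (G : Type*) [Group G] [Group.FG G]
    [Group.IsNilpotent G] : WellFoundedGT (Subgroup G) := by
  obtain ⟨n, hn⟩ := Subgroup.nilpotent_iff_lowerCentralSeries.1 ‹Group.IsNilpotent G›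
  exact Group.wellFoundedGT_subgroup_of_lowerCentralSeries_eq_bot n G hn

theorem commutatorElement_pow_left {G : Type*} [Group G] {a g : G} (h : Commute a ⁅a, g⁆)
    (n : ℕ) : ⁅a ^ n, g⁆ = ⁅a, g⁆ ^ n := by
  have h₁ : g * a⁻¹ * g⁻¹ = a⁻¹ * ⁅a, g⁆ := by rw [commutatorElement_def]; group
  calc ⁅a ^ n, g⁆ = a ^ n * (g * a⁻¹ * g⁻¹) ^ n := by
        rw [commutatorElement_def, conj_pow, inv_pow]; group
    _ = ⁅a, g⁆ ^ n := by rw [h₁, h.inv_left.mul_pow, inv_pow, mul_inv_cancel_left]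

theorem commutatorElement_pow_right {G : Type*} [Group G] {a g : G} (h : Commute g ⁅a, g⁆)
    (n : ℕ) : ⁅a, g ^ n⁆ = ⁅a, g⁆ ^ n := by
  have h₁ : a * g * a⁻¹ = ⁅a, g⁆ * g := by rw [commutatorElement_def]; group
  rw [commutatorElement_def, ← conj_pow, h₁, h.symm.mul_pow, mul_inv_cancel_right]

theorem IsMulCommutative.finite_of_fg {A : Type*} [Group A] [IsMulCommutative A] [Group.FG A]
    (h : ∀ a : A, ∃ n, 0 < n ∧ a ^ n = 1) : Finite A := by
  let _ : CommGroup A := { (inferInstance : Group A) with mul_comm := mul_comm' }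
  exact CommGroup.finite_of_fg_isMulTorsion _ fun a => isOfFinOrder_iff_pow_eq_one.2 (h a)

theorem Group.IsNilpotent.finite_of_center_pow_eq_one (n : ℕ) (hn : n ≠ 0) (G : Type*) [Group G]
    [hG : Group.IsNilpotent G] [hw : WellFoundedGT (Subgroup G)]
    (h : ∀ z ∈ center G, z ^ n = 1) : Finite G ∧ ∀ x : G, ∃ k, x ^ n ^ k = 1 := by
  refine Group.nilpotent_center_quotient_ind
    (P := fun G _ _ => WellFoundedGT (Subgroup G) → (∀ z ∈ center G, z ^ n = 1) →
      Finite G ∧ ∀ x : G, ∃ k, x ^ n ^ k = 1) G ?_ ?_ hw h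
  · exact fun G _ _ _ _ => ⟨inferInstance, fun x => ⟨0, Subsingleton.elim _ _⟩⟩
  · intro G _ _ ih hw h
    obtain ⟨hfin, hpow⟩ := ih inferInstance fun z hz => by
      obtain ⟨z, rfl⟩ := QuotientGroup.mk'_surjective _ z
      rw [← map_pow, QuotientGroup.mk'_apply, QuotientGroup.eq_one_iff]
      refine mem_center_iff.2 fun g => ?_
      have hc : ⁅z, g⁆ ∈ center G := by
        rw [← QuotientGroup.eq_one_iff, ← QuotientGroup.mk'_apply, map_commutatorElement,
          commutatorElement_eq_one_iff_mul_comm]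
        exact (mem_center_iff.1 hz _).symm
      rw [eq_comm, ← commutatorElement_eq_one_iff_mul_comm,
        commutatorElement_pow_left (mem_center_iff.1 hc z), h _ hc]
    have hZ : Finite (center G) := IsMulCommutative.finite_of_fg fun z =>
      ⟨n, hn.bot_lt, Subtype.ext (h z z.2)⟩
    refine ⟨Finite.of_equiv _ (groupEquivQuotientProdSubgroup (s := center G)).symm, fun x => ?_⟩
    obtain ⟨k, hk⟩ := hpow (x : G ⧸ center G)
    rw [← QuotientGroup.mk_pow, QuotientGroup.eq_one_iff] at hk
    exact ⟨k + 1, by rw [pow_succ, pow_mul, h _ hk]⟩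

/-- In a nilpotent group with the maximal condition on subgroups, an element of order `p` modulo
a normal subgroup survives in a finite `p`-quotient. -/
theorem Group.IsNilpotent.exists_normal_isPGroup_quotient {G : Type*} [Group G]
    [Group.IsNilpotent G] [WellFoundedGT (Subgroup G)] {p : ℕ} [hp : Fact p.Prime]
    (T : Subgroup G) [hT : T.Normal] {x : G} (hx : x ∉ T) (hxp : x ^ p ∈ T) :
    ∃ N : Subgroup G, ∃ _ : N.Normal, T ≤ N ∧ x ∉ N ∧ Finite (G ⧸ N) ∧ IsPGroup p (G ⧸ N) := by
  obtain ⟨N, ⟨hN, hTN, hxN⟩, hmax⟩ := WellFounded.has_min (wellFounded_gt (α := Subgroup G))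
    {N | N.Normal ∧ T ≤ N ∧ x ∉ N} ⟨T, hT, le_rfl, hx⟩
  have hord : orderOf (x : G ⧸ N) = p := by
    refine orderOf_eq_prime ?_ fun h => hxN ((QuotientGroup.eq_one_iff x).1 h)
    rw [← QuotientGroup.mk_pow, QuotientGroup.eq_one_iff]
    exact hTN hxp
  have hmem : ∀ z ∈ center (G ⧸ N), z ≠ 1 → (x : G ⧸ N) ∈ zpowers z := by
    intro z hz hz1
    by_contra hxz
    have hn : (zpowers z).Normal := ⟨fun y hy g => by
      have : y ∈ center (G ⧸ N) := (zpowers_le.2 hz) hy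
      rwa [mem_center_iff.1 this g, mul_inv_cancel_right]⟩
    have hle : N ≤ (zpowers z).comap (QuotientGroup.mk' N) := fun y hy => by
      rw [mem_comap, QuotientGroup.mk'_apply, (QuotientGroup.eq_one_iff y).2 hy]
      exact one_mem _
    refine hmax ((zpowers z).comap (QuotientGroup.mk' N))
      ⟨hn.comap _, hTN.trans hle, hxz⟩ (lt_of_le_of_ne hle fun h => hz1 ?_)
    obtain ⟨y, rfl⟩ := QuotientGroup.mk'_surjective _ z
    refine (QuotientGroup.eq_one_iff y).2 ?_
    rw [h]
    exact mem_zpowers _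
  have hpow : ∀ z ∈ center (G ⧸ N), ∃ k, orderOf z = p ^ k := by
    intro z hz
    rcases eq_or_ne z 1 with rfl | hz1
    · exact ⟨0, by simp⟩
    have hfin : orderOf z ≠ 0 := by
      obtain ⟨r, hr⟩ := hmem z hz hz1
      have hr0 : r ≠ 0 := by
        rintro rfl
        rw [← hr] at hord
        simp only [zpow_zero, orderOf_one] at hord
        exact hp.out.one_lt.ne hord
      refine (isOfFinOrder_iff_zpow_eq_one.2
        ⟨r * p, mul_ne_zero hr0 (by exact_mod_cast hp.out.ne_zero), ?_⟩).orderOf_pos.ne'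
      dsimp only at hr
      rw [zpow_mul, hr, zpow_natCast, ← hord, pow_orderOf_eq_one]
    refine ⟨_, Nat.eq_prime_pow_of_unique_prime_dvd hfin fun {q} hq hqz => ?_⟩
    have hw : orderOf (z ^ (orderOf z / q)) = q := orderOf_pow_orderOf_div hfin hqz
    have hxw := hmem _ (pow_mem hz (orderOf z / q)) fun h => by
      rw [h, orderOf_one] at hw
      exact hq.one_lt.ne hw
    have := orderOf_dvd_of_mem_zpowers hxw
    rw [hord, hw] at this
    exact ((Nat.prime_dvd_prime_iff_eq hp.out hq).1 this).symm
  have hZ : IsPGroup p (center (G ⧸ N)) := IsPGroup.iff_orderOf.2 fun z => by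
    obtain ⟨k, hk⟩ := hpow z z.2
    exact ⟨k, by rw [← hk, orderOf_coe]⟩
  have : Finite (center (G ⧸ N)) := IsMulCommutative.finite_of_fg fun z => by
    obtain ⟨k, hk⟩ := hZ z
    exact ⟨_, pow_pos hp.out.pos k, hk⟩
  obtain ⟨k, hk⟩ := IsPGroup.iff_card.1 hZ
  obtain ⟨hfin, hQ⟩ := Group.IsNilpotent.finite_of_center_pow_eq_one (p ^ k)
    (pow_ne_zero _ hp.out.ne_zero) (G ⧸ N) fun z hz => by
      rw [← hk]
      exact congrArg Subtype.val (pow_card_eq_one' (x := (⟨z, hz⟩ : center (G ⧸ N))))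
  refine ⟨N, hN, hTN, hxN, hfin, fun y => ?_⟩
  obtain ⟨j, hj⟩ := hQ y
  exact ⟨k * j, by rwa [pow_mul]⟩

theorem Group.IsNilpotent.le_center_of_coprime {Q : Type*} [Group Q] [hQ : Group.IsNilpotent Q]
    {A : Subgroup Q} [A.Normal] {m q : ℕ} (hmq : m.Coprime q) (hA : ∀ a ∈ A, a ^ q = 1)
    (hm : ∀ g : Q, ∀ a ∈ A, Commute a (g ^ m)) : A ≤ center Q := by
  have key : ∀ i, A ⊓ Subgroup.upperCentralSeries Q i ≤ center Q := by
    intro i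
    induction i with
    | zero => simp
    | succ i ih =>
      rintro a ⟨haA, hai⟩
      refine mem_center_iff.2 fun g => ?_
      have hcA : ⁅a, g⁆ ∈ A :=
        commutator_le_left A (⊤ : Subgroup Q) (commutator_mem_commutator haA (mem_top g))
      have hc : ⁅a, g⁆ ∈ center Q := ih ⟨hcA, Subgroup.mem_upperCentralSeries_succ_iff.1 hai g⟩
      have h₁ : ⁅a, g⁆ ^ m = 1 := by
        rw [← commutatorElement_pow_right (mem_center_iff.1 hc g), (hm g a haA).commutator_eq]
      rw [eq_comm, ← commutatorElement_eq_one_iff_mul_comm, ← orderOf_eq_one_iff]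
      exact Nat.eq_one_of_dvd_coprimes hmq (orderOf_dvd_of_pow_eq_one h₁)
        (orderOf_dvd_of_pow_eq_one (hA _ hcA))
  obtain ⟨n, hn⟩ := hQ.nilpotent'
  exact fun a ha => key n ⟨ha, hn ▸ mem_top a⟩

theorem CommGroup.mem_torsion_of_forall_mem_range_pow {A : Type*} [CommGroup A] [Group.FG A]
    {p : ℕ} (hp : p.Prime) {w : A} (hw : ∀ k, ∃ b : A, b ^ p ^ k = w) :
    w ∈ CommGroup.torsion A := by
  have : Module.Finite ℤ (Additive A) := Module.Finite.iff_addGroup_fg.2 inferInstance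
  obtain ⟨⟨r, hr⟩, hrw⟩ := ((Ideal.span {(p : ℤ)}).mem_iInf_smul_pow_eq_bot_iff
      (Additive.ofMul w)).1 <| by
    rw [Submodule.mem_iInf]
    intro k
    obtain ⟨b, rfl⟩ := hw k
    rw [ofMul_pow, ← natCast_zsmul]
    refine Submodule.smul_mem_smul ?_ trivial
    rw [Nat.cast_pow]
    exact Ideal.pow_mem_pow (Ideal.mem_span_singleton_self _) k
  have hr1 : r - 1 ≠ 0 := by
    intro h
    rw [sub_eq_zero.1 h, Ideal.mem_span_singleton] at hr
    exact hp.one_lt.ne' (by exact_mod_cast Int.eq_one_of_dvd_one (by positivity) hr)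
  refine isOfFinOrder_iff_zpow_eq_one.2 ⟨r - 1, hr1, ?_⟩
  have : w ^ r = w := congrArg Additive.toMul hrw
  rw [zpow_sub, this, zpow_one, mul_inv_cancel]

theorem Subgroup.center_ne_bot_of_forall_quotient_isNilpotent {Q : Type*} [Group Q]
    [WellFoundedGT (Subgroup Q)] (A : Subgroup Q) [hAn : A.Normal] [IsMulCommutative A]
    [Infinite A] {m : ℕ} (hm0 : m ≠ 0) (hm : ∀ g : Q, ∀ a ∈ A, Commute a (g ^ m))
    (h : ∀ (B : Subgroup Q) [B.Normal], B ≠ ⊥ → Group.IsNilpotent (Q ⧸ B)) :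
    center Q ≠ ⊥ := by
  let _ : CommGroup A := { (inferInstance : Group A) with mul_comm := mul_comm' }
  have hpow : ∀ n ≠ 0, ∃ a : A, a ^ n ≠ 1 := by
    intro n hn
    by_contra! hc
    have : Finite A := IsMulCommutative.finite_of_fg fun a => ⟨n, hn.bot_lt, hc a⟩
    exact not_finite A
  obtain ⟨p, hpm, hp⟩ := Nat.exists_infinite_primes (m + 1)
  have hcop : m.Coprime p := ((Nat.Prime.coprime_iff_not_dvd hp).2 fun hd =>
    absurd (Nat.le_of_dvd hm0.bot_lt hd) (by omega)).symm
  have htor : ∀ (a : A) (g : Q), ∃ t : CommGroup.torsion A, ((t : A) : Q) = ⁅(a : Q), g⁆ := by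
    intro a g
    have hcA : ⁅(a : Q), g⁆ ∈ A :=
      commutator_le_left A (⊤ : Subgroup Q) (commutator_mem_commutator a.2 (mem_top g))
    refine ⟨⟨⟨_, hcA⟩, CommGroup.mem_torsion_of_forall_mem_range_pow hp fun k => ?_⟩, rfl⟩
    have hq0 : p ^ k ≠ 0 := pow_ne_zero _ hp.ne_zero
    set B : Subgroup Q := (powMonoidHom (p ^ k) : A →* A).range.map A.subtype with hB
    have hmemB : ∀ x, x ∈ B ↔ ∃ b ∈ A, b ^ p ^ k = x := by
      intro x
      simp only [hB, Subgroup.mem_map, MonoidHom.mem_range, powMonoidHom_apply]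
      exact ⟨by rintro ⟨_, ⟨b, rfl⟩, rfl⟩; exact ⟨b, b.2, rfl⟩,
        by rintro ⟨b, hb, rfl⟩; exact ⟨_, ⟨⟨b, hb⟩, rfl⟩, rfl⟩⟩
    have hBn : B.Normal := ⟨fun x hx y => by
      obtain ⟨b, hb, rfl⟩ := (hmemB x).1 hx
      exact (hmemB _).2 ⟨y * b * y⁻¹, hAn.conj_mem b hb y, conj_pow⟩⟩
    have hBbot : B ≠ ⊥ := by
      obtain ⟨b, hb⟩ := hpow _ hq0
      intro hbot
      have : (b : Q) ^ p ^ k ∈ B := (hmemB _).2 ⟨b, b.2, rfl⟩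
      rw [hbot, mem_bot] at this
      exact hb (Subtype.ext this)
    have := h B hBbot
    have hAn' : (A.map (QuotientGroup.mk' B)).Normal :=
      hAn.map _ (QuotientGroup.mk'_surjective B)
    have hle : A.map (QuotientGroup.mk' B) ≤ center (Q ⧸ B) := by
      refine Group.IsNilpotent.le_center_of_coprime (hcop.pow_right k) ?_ ?_
      · rintro _ ⟨b, hb, rfl⟩
        rw [← map_pow, QuotientGroup.mk'_apply, QuotientGroup.eq_one_iff]
        exact (hmemB _).2 ⟨b, hb, rfl⟩
      · rintro g _ ⟨b, hb, rfl⟩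
        obtain ⟨g, rfl⟩ := QuotientGroup.mk'_surjective B g
        rw [← map_pow]
        exact (hm g b hb).map _
    have hmem := mem_center_iff.1 (hle (mem_map_of_mem _ a.2)) (QuotientGroup.mk' B g)
    rw [eq_comm, ← commutatorElement_eq_one_iff_mul_comm, ← map_commutatorElement,
      QuotientGroup.mk'_apply, QuotientGroup.eq_one_iff, hmemB] at hmem
    obtain ⟨b, hb, hbw⟩ := hmem
    exact ⟨⟨b, hb⟩, Subtype.ext hbw⟩
  have : Finite (CommGroup.torsion A) := IsMulCommutative.finite_of_fg fun t => by
    obtain ⟨n, hn, ht⟩ := isOfFinOrder_iff_pow_eq_one.1 t.2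
    exact ⟨n, hn, Subtype.ext ht⟩
  obtain ⟨a, ha⟩ := hpow (Nat.card (CommGroup.torsion A)) Nat.card_pos.ne'
  intro hbot
  refine ha (Subtype.ext ((mem_bot (G := Q)).1 (hbot ▸ mem_center_iff.2 fun g => ?_)))
  obtain ⟨t, ht⟩ := htor a g
  have hcom : Commute (a : Q) ⁅(a : Q), g⁆ := by
    rw [← ht]
    exact congrArg Subtype.val (mul_comm a (t : A))
  rw [eq_comm, ← commutatorElement_eq_one_iff_mul_comm, SubgroupClass.coe_pow,
    commutatorElement_pow_left hcom, ← ht]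
  exact congrArg (fun s : CommGroup.torsion A => ((s : A) : Q)) (pow_card_eq_one' (x := t))

theorem Group.exists_finiteIndex_quotient_not_isNilpotent {G : Type*} [Group G]
    [WellFoundedGT (Subgroup G)] (hG : ¬ Group.IsNilpotent G) (L : Subgroup G) [hL : L.Normal]
    [hfi : L.FiniteIndex] [hnil : Group.IsNilpotent L] :
    ∃ M : Subgroup G, ∃ _ : M.Normal, M.FiniteIndex ∧ ¬ Group.IsNilpotent (G ⧸ M) := by
  by_contra! hfin
  obtain ⟨N, ⟨hN, hGN⟩, hmax⟩ := WellFounded.has_min (wellFounded_gt (α := Subgroup G))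
    {N | ∃ _ : N.Normal, ¬ Group.IsNilpotent (G ⧸ N)}
    ⟨⊥, inferInstance, fun h => hG (Group.nilpotent_of_mulEquiv QuotientGroup.quotientBot)⟩
  have hquot : ∀ (B : Subgroup (G ⧸ N)) [B.Normal], B ≠ ⊥ →
      Group.IsNilpotent ((G ⧸ N) ⧸ B) := by
    intro B hB hBbot
    have hB' : (B.comap (QuotientGroup.mk' N)).Normal := hB.comap _
    have hle : N ≤ B.comap (QuotientGroup.mk' N) := fun y hy => by
      rw [mem_comap, QuotientGroup.mk'_apply, (QuotientGroup.eq_one_iff y).2 hy]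
      exact one_mem _
    have hn : Group.IsNilpotent (G ⧸ B.comap (QuotientGroup.mk' N)) := by
      by_contra hc
      refine hmax _ ⟨hB', hc⟩ (lt_of_le_of_ne hle fun h => hBbot ?_)
      rw [eq_bot_iff]
      intro y hy
      obtain ⟨y, rfl⟩ := QuotientGroup.mk'_surjective _ y
      refine (QuotientGroup.eq_one_iff y).2 ?_
      rw [h]
      exact hy
    refine Group.nilpotent_of_surjective
      (QuotientGroup.map _ B (QuotientGroup.mk' N) le_rfl) ?_
    exact QuotientGroup.map_surjective_of_surjective _ _ _
      ((QuotientGroup.mk'_surjective B).comp (QuotientGroup.mk'_surjective N)) _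
  have hQinf : ¬ Finite (G ⧸ N) := fun h =>
    hGN (hfin N hN (finiteIndex_of_finite_quotient))
  set L' := L.map (QuotientGroup.mk' N) with hL'
  have hL'n : L'.Normal := hL.map _ (QuotientGroup.mk'_surjective N)
  have hL'nil : Group.IsNilpotent L' := Group.nilpotent_of_surjective
    ((QuotientGroup.mk' N).subgroupMap L) ((QuotientGroup.mk' N).subgroupMap_surjective L)
  have hL'fi : L'.FiniteIndex := ⟨fun h => hfi.index_ne_zero <|
    Nat.eq_zero_of_zero_dvd (h ▸ L.index_map_dvd (QuotientGroup.mk'_surjective N))⟩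
  have hL'inf : ¬ Finite L' := fun _ =>
    hQinf (Finite.of_equiv _ (groupEquivQuotientProdSubgroup (s := L')).symm)
  have hAinf : Infinite (center L') := by
    by_contra h
    rw [not_infinite_iff_finite] at h
    refine hL'inf (Group.IsNilpotent.finite_of_center_pow_eq_one (Nat.card (center L'))
      Nat.card_pos.ne' L' fun z hz => ?_).1
    exact congrArg Subtype.val (pow_card_eq_one' (x := (⟨z, hz⟩ : center L')))
  set A := (center L').map L'.subtype with hA
  have : Infinite A := ((center L').equivMapOfInjective _
    L'.subtype_injective).toEquiv.infinite_iff.1 hAinf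
  refine hGN (Group.of_quotient_center_nilpotent (hquot _ ?_))
  refine center_ne_bot_of_forall_quotient_isNilpotent A hL'fi.index_ne_zero ?_ hquot
  rintro g _ ⟨a, ha, rfl⟩
  exact congrArg Subtype.val
    (mem_center_iff.1 ha ⟨g ^ L'.index, L'.pow_index_mem g⟩).symm

theorem mul_pow_eq_of_commute_commutatorElement {G : Type*} [Group G] {b c : G}
    (hb : Commute ⁅c, b⁆ b) (hc : Commute ⁅c, b⁆ c) (n : ℕ) :
    (b * c) ^ n = b ^ n * c ^ n * ⁅c, b⁆ ^ n.choose 2 := by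
  set z := ⁅c, b⁆ with hz
  have hcb : ∀ n : ℕ, c ^ n * b = b * c ^ n * z ^ n := by
    intro n
    have h : c ^ n * b = ⁅c ^ n, b⁆ * b * c ^ n := by rw [commutatorElement_def]; group
    rw [h, commutatorElement_pow_left hc.symm, mul_assoc,
      ((hb.mul_right (hc.pow_right n)).pow_left n).eq]
  induction n with
  | zero => simp
  | succ n ih =>
    rw [pow_succ, ih, mul_assoc, ((hb.mul_right hc).pow_left _).eq, ← mul_assoc, ← mul_assoc,
      mul_assoc (b ^ n), hcb, Nat.choose_succ_succ' n 1, Nat.choose_one_right, pow_add, pow_succ b,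
      pow_succ c, ← mul_assoc, mul_assoc _ (z ^ n) c, (hc.pow_left n).eq]
    simp only [mul_assoc, pow_add, pow_zero, one_mul, Nat.reduceAdd]

theorem IsPGroup.commute_of_forall_normal {Q : Type*} [Group Q] [Finite Q] {p : ℕ}
    [Fact p.Prime] (hp2 : p ≠ 2) (hQ : IsPGroup p Q) (hn : ∀ H : Subgroup Q, H.Normal)
    (a b : Q) : Commute a b := by
  have hp : p.Prime := Fact.out
  induction hs : orderOf a + orderOf b using Nat.strong_induction_on generalizing a b with
  | _ s ih =>
  wlog hab : orderOf b ≤ orderOf a generalizing a b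
  · exact (this b a (by omega) (by omega)).symm
  subst hs
  by_contra hcomm
  have hz1 : ⁅a, b⁆ ≠ 1 := fun h => hcomm (commutatorElement_eq_one_iff_commute.1 h)
  set z := ⁅a, b⁆ with hz
  have hza : z ∈ zpowers a := by
    rw [hz, commutatorElement_def, mul_assoc, mul_assoc, ← mul_assoc b]
    exact mul_mem (mem_zpowers a) ((hn _).conj_mem _ (inv_mem (mem_zpowers a)) b)
  have hzb : z ∈ zpowers b := by
    rw [hz, commutatorElement_def]
    exact mul_mem ((hn _).conj_mem _ (mem_zpowers b) a) (inv_mem (mem_zpowers b))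
  have haz : Commute a z := by
    obtain ⟨k, hk⟩ := mem_zpowers_iff.1 hza
    exact hk ▸ (Commute.refl a).zpow_right k
  have hbz : Commute b z := by
    obtain ⟨k, hk⟩ := mem_zpowers_iff.1 hzb
    exact hk ▸ (Commute.refl b).zpow_right k
  obtain ⟨α, hα⟩ := IsPGroup.iff_orderOf.1 hQ a
  obtain ⟨β, hβ⟩ := IsPGroup.iff_orderOf.1 hQ b
  have hβα : β ≤ α := (Nat.pow_le_pow_iff_right hp.one_lt).1 (by rwa [← hα, ← hβ])
  have hβ0 : β ≠ 0 := by
    rintro rfl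
    rw [pow_zero, orderOf_eq_one_iff] at hβ
    exact hcomm (hβ ▸ Commute.one_right a)
  obtain ⟨β, rfl⟩ := Nat.exists_eq_add_of_lt (Nat.pos_of_ne_zero hβ0)
  obtain ⟨α, rfl⟩ := Nat.exists_eq_add_of_le hβα
  rw [zero_add] at *
  have hzp : z ^ p = 1 := by
    rw [← commutatorElement_pow_left haz, commutatorElement_eq_one_iff_commute]
    refine ih _ ?_ (a ^ p) b rfl
    have : p ∣ orderOf a := hα ▸ dvd_pow_self p (by omega)
    rw [orderOf_pow_of_dvd hp.ne_zero this]
    have := Nat.div_lt_self (orderOf_pos a) hp.one_lt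
    omega
  obtain ⟨j, hj⟩ := mem_powers_iff_mem_zpowers.2 hzb
  obtain ⟨i, hi⟩ := mem_powers_iff_mem_zpowers.2 (inv_mem hza)
  simp only at hi hj
  have hpj : p ^ β ∣ j := by
    have : orderOf b ∣ j * p := orderOf_dvd_of_pow_eq_one (by rw [pow_mul, hj, hzp])
    rw [hβ, pow_succ] at this
    exact Nat.dvd_of_mul_dvd_mul_right hp.pos this
  have hpi : p ^ (β + α) ∣ i := by
    have : orderOf a ∣ i * p := orderOf_dvd_of_pow_eq_one (by
      rw [pow_mul, hi, inv_pow, hzp, inv_one])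
    rw [hα, add_right_comm, pow_succ] at this
    exact Nat.dvd_of_mul_dvd_mul_right hp.pos this
  obtain ⟨j, rfl⟩ := hpj
  obtain ⟨i, rfl⟩ := hpi
  have hpj : ¬ p ∣ j := by
    rintro ⟨j, rfl⟩
    refine hz1 (hj.symm.trans ?_)
    rw [← mul_assoc, ← pow_succ, ← hβ, pow_mul, pow_orderOf_eq_one, one_pow]
  have hzj : ⁅a, b ^ j⁆ = z ^ j := commutatorElement_pow_right hbz _
  have hw : ⁅a ^ (p ^ α * i), b ^ j⁆ = z ^ (j * (p ^ α * i)) := by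
    rw [commutatorElement_pow_left (by rw [hzj]; exact haz.pow_right j), hzj]
    simp only [pow_mul]
  have hwp : ⁅a ^ (p ^ α * i), b ^ j⁆ ^ p = 1 := by
    rw [hw, ← pow_mul, mul_comm, pow_mul, hzp, one_pow]
  have hpow : (b ^ j * a ^ (p ^ α * i)) ^ p ^ β = ⁅a ^ (p ^ α * i), b ^ j⁆ ^ (p ^ β).choose 2 := by
    rw [mul_pow_eq_of_commute_commutatorElement
      (by rw [hw]; exact (hbz.pow_pow _ _).symm) (by rw [hw]; exact (haz.pow_pow _ _).symm),
      ← pow_mul, ← pow_mul, mul_comm j, hj, mul_right_comm, ← pow_add, add_comm α, hi,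
      mul_inv_cancel, one_mul]
  have hpow1 : (b ^ j * a ^ (p ^ α * i)) ^ p ^ β = 1 := by
    rw [hpow]
    obtain rfl | hβ0 := Nat.eq_zero_or_pos β
    · simp
    · have h2 : 2 ≠ p ^ β := fun h => hp2 (((Nat.prime_dvd_prime_iff_eq hp Nat.prime_two).1
        (h ▸ dvd_pow_self p hβ0.ne')))
      obtain ⟨t, ht⟩ := hp.dvd_choose_pow two_ne_zero h2
      rw [ht, pow_mul, hwp, one_pow]
  have hc : Commute a (b ^ j * a ^ (p ^ α * i)) := by
    refine ih _ ?_ _ _ rfl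
    have h1 := orderOf_le_of_pow_eq_one (pow_pos hp.pos β) hpow1
    have h2 : p ^ β < p ^ (β + 1) := Nat.pow_lt_pow_right hp.one_lt (by omega)
    omega
  have hc' : Commute a (b ^ j) := by
    have := hc.mul_right ((Commute.refl a).pow_right (p ^ α * i)).inv_right
    rwa [mul_inv_cancel_right] at this
  rw [← commutatorElement_eq_one_iff_commute, hzj] at hc'
  refine hz1 (orderOf_eq_one_iff.1 (Nat.eq_one_of_dvd_coprimes
    ((Nat.Prime.coprime_iff_not_dvd hp).2 hpj)
    (orderOf_dvd_of_pow_eq_one hzp) (orderOf_dvd_of_pow_eq_one hc')))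

theorem Subgroup.lt_inf_of_normalizer_le {G : Type*} [Group G] {D M K : Subgroup G}
    [Group.IsNilpotent M] (hDM : D < M) (hK : normalizer (D : Set G) ≤ K) : D < K ⊓ M := by
  refine lt_of_le_of_ne (le_inf (le_normalizer.trans hK) hDM.le) fun h => ?_
  have hlt : D.subgroupOf M < ⊤ := lt_top_iff_ne_top.2 fun h => hDM.not_ge (subgroupOf_eq_top.1 h)
  refine (Group.normalizerCondition_of_isNilpotent _ hlt).not_ge fun x hx => ?_
  rw [← subgroupOf_normalizer_eq hDM.le, mem_subgroupOf] at hx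
  rw [mem_subgroupOf, h]
  exact ⟨hK hx, x.2⟩

theorem IsSimpleGroup.inf_eq_bot_of_isCoatom {G : Type*} [Group G] [Finite G] [IsSimpleGroup G]
    (hnil : ∀ H : Subgroup G, H ≠ ⊤ → Group.IsNilpotent H) {M L : Subgroup G} (hM : IsCoatom M)
    (hL : IsCoatom L) (hML : M ≠ L) : M ⊓ L = ⊥ := by
  by_contra hbot
  obtain ⟨D, ⟨hD, M, L, hM, hL, hML, rfl⟩, hmax⟩ := (Set.toFinite
    {D : Subgroup G | D ≠ ⊥ ∧ ∃ M L, IsCoatom M ∧ IsCoatom L ∧ M ≠ L ∧ D = M ⊓ L}).exists_maximal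
    ⟨_, hbot, M, L, hM, hL, hML, rfl⟩
  have hDM : M ⊓ L < M := lt_of_le_of_ne inf_le_left fun h =>
    hML ((hM.le_iff_eq hL.1).1 (inf_eq_left.1 h)).symm
  have hDL : M ⊓ L < L := lt_of_le_of_ne inf_le_right fun h =>
    hML ((hL.le_iff_eq hM.1).1 (inf_eq_right.1 h))
  obtain hN | ⟨K, hK, hNK⟩ := eq_top_or_exists_le_coatom (normalizer ((M ⊓ L : Subgroup G) : Set G))
  · obtain h | h := (normalizer_eq_top_iff.1 hN).eq_bot_or_eq_top
    · exact hD h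
    · exact hDM.not_ge (h ▸ le_top)
  have key : ∀ N, IsCoatom N → M ⊓ L < N → K = N := by
    intro N hN hlt
    by_contra hKN
    have := hnil N hN.1
    have hlt' := lt_inf_of_normalizer_le hlt hNK
    exact hlt'.not_ge (hmax ⟨(bot_le.trans_lt hlt').ne', K, N, hK, hN, hKN, rfl⟩ hlt'.le)
  exact hML ((key M hM hDM).symm.trans (key L hL hDL))

theorem IsSimpleGroup.isSolvable_of_forall_isNilpotent {G : Type*} [Group G] [Finite G]
    [IsSimpleGroup G] (hnil : ∀ H : Subgroup G, H ≠ ⊤ → Group.IsNilpotent H) :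
    Group.IsSolvable G := by
  by_contra hsol
  have hcyc : ∀ x : G, zpowers x ≠ ⊤ := fun x hx => hsol <| Group.isSolvable_of_comm fun a b => by
    obtain ⟨i, rfl⟩ := mem_zpowers_iff.1 (hx ▸ mem_top a)
    obtain ⟨j, rfl⟩ := mem_zpowers_iff.1 (hx ▸ mem_top b)
    exact (Commute.refl x).zpow_zpow i j
  have hex : ∀ x : G, ∃ M : Subgroup G, IsCoatom M ∧ x ∈ M := fun x => by
    obtain h | ⟨M, hM, h⟩ := eq_top_or_exists_le_coatom (zpowers x)
    · exact absurd h (hcyc x)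
    · exact ⟨M, hM, h (mem_zpowers x)⟩
  have hdisj : ∀ {M L : Subgroup G}, IsCoatom M → IsCoatom L → ∀ {x : G}, x ≠ 1 → x ∈ M → x ∈ L →
      M = L := by
    intro M L hM hL x hx hxM hxL
    by_contra hML
    exact hx (mem_bot.1 (inf_eq_bot_of_isCoatom hnil hM hL hML ▸ mem_inf.2 ⟨hxM, hxL⟩))
  have hbot : ∀ {M : Subgroup G}, IsCoatom M → M ≠ ⊥ := by
    rintro _ hM rfl
    obtain ⟨x, hx⟩ := exists_ne (1 : G)
    exact hcyc x (hM.2 _ (bot_lt_iff_ne_bot.2 (zpowers_ne_bot.2 hx)))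
  have hself : ∀ {M : Subgroup G}, IsCoatom M → normalizer (M : Set G) = M := by
    intro M hM
    refine (hM.le_iff_eq fun h => ?_).1 le_normalizer
    obtain h | h := (normalizer_eq_top_iff.1 h).eq_bot_or_eq_top
    exacts [hbot hM h, hM.1 h]
  have hconj : ∀ {M : Subgroup G} (g : G), IsCoatom M → IsCoatom (MulAut.conj g • M) :=
    fun g hM => ((MulAut.conj g).mapSubgroup.isCoatom_iff _).2 hM
  have hmem : ∀ {M : Subgroup G} (g : G) {x : G}, x ∈ M → g * x * g⁻¹ ∈ MulAut.conj g • M :=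
    fun g x hx => smul_mem_pointwise_smul _ (MulAut.conj g) _ hx
  have hinj : ∀ {M : Subgroup G}, IsCoatom M → ∀ {g h : G},
      MulAut.conj g • M = MulAut.conj h • M → (g : G ⧸ M) = h := by
    intro M hM g h heq
    rw [QuotientGroup.eq]
    have : g⁻¹ * h ∈ normalizer (M : Set G) := by
      rw [mem_normalizer_iff_map_conj_eq]
      change MulAut.conj (g⁻¹ * h) • M = M
      rw [map_mul, mul_smul, ← heq, map_inv, inv_smul_smul]
    rwa [hself hM] at this
  let F (M : Subgroup G) (y : (G ⧸ M) × {x : M // x ≠ 1}) : {x : G // x ≠ 1} :=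
    ⟨y.1.out * y.2 * y.1.out⁻¹, by
      rw [Ne, conj_eq_one_iff, OneMemClass.coe_eq_one]
      exact y.2.2⟩
  have hF : ∀ {M L : Subgroup G}, IsCoatom M → IsCoatom L → ∀ {y z}, F M y = F L z →
      MulAut.conj y.1.out • M = MulAut.conj z.1.out • L := by
    intro M L hM hL y z h
    have h' : y.1.out * (y.2 : M) * y.1.out⁻¹ = z.1.out * (z.2 : L) * z.1.out⁻¹ :=
      congrArg Subtype.val h
    refine hdisj (hconj _ hM) (hconj _ hL) (F M y).2 (hmem _ y.2.1.2) ?_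
    have := hmem z.1.out z.2.1.2
    rwa [← h'] at this
  have hFinj : ∀ {M : Subgroup G}, IsCoatom M → (F M).Injective := by
    rintro M hM ⟨q, x⟩ ⟨r, y⟩ h
    have hqr : q = r := by simpa using hinj hM (hF hM hM h)
    subst hqr
    have h' : q.out * (x : M) * q.out⁻¹ = q.out * (y : M) * q.out⁻¹ := congrArg Subtype.val h
    rw [mul_left_inj, mul_right_inj] at h'
    rw [Prod.mk.injEq]
    exact ⟨rfl, Subtype.ext (Subtype.ext h')⟩
  have hcard1 : ∀ (H : Type _) [Group H] [Finite H], Nat.card {x : H // x ≠ 1} + 1 = Nat.card H := by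
    intro H _ _
    have := Fintype.ofFinite H
    classical
    have := Fintype.card_pos (α := H)
    rw [Nat.card_eq_fintype_card, Nat.card_eq_fintype_card, Fintype.card_subtype_compl,
      Fintype.card_subtype_eq]
    omega
  have hcard : ∀ {M : Subgroup G}, IsCoatom M → 2 ≤ M.index ∧ 2 ≤ Nat.card M ∧
      Nat.card ((G ⧸ M) × {x : M // x ≠ 1}) + M.index = Nat.card G := by
    intro M hM
    refine ⟨?_, ?_, ?_⟩
    · have := M.index_ne_zero_of_finite
      have := index_eq_one.not.2 hM.1
      omega
    · have := (Subgroup.one_lt_card_iff_ne_bot M).2 (hbot hM)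
      omega
    · rw [Nat.card_prod, ← M.card_mul_index, ← hcard1 M, index]
      ring
  obtain ⟨M, hM, -⟩ := hex 1
  obtain ⟨hM1, hM2, hM3⟩ := hcard hM
  have hG := hcard1 G
  have hMG := M.card_mul_index
  by_cases hall : ∀ L : Subgroup G, IsCoatom L → ∃ g : G, L = MulAut.conj g • M
  · have hsurj : (F M).Surjective := by
      rintro ⟨x, hx⟩
      obtain ⟨L, hL, hxL⟩ := hex x
      obtain ⟨g, rfl⟩ := hall L hL
      have hg : g⁻¹ * (g : G ⧸ M).out ∈ M := QuotientGroup.eq.1 (QuotientGroup.out_eq' _).symm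
      have hx' : (g : G ⧸ M).out⁻¹ * x * (g : G ⧸ M).out ∈ M := by
        rw [← conj_smul_eq_self_of_mem hg, ← mul_smul, ← map_mul, mul_inv_cancel_left] at hxL
        simpa using mem_pointwise_smul_iff_inv_smul_mem.1 hxL
      refine ⟨⟨g, ⟨_, hx'⟩, fun h => hx ?_⟩, Subtype.ext ?_⟩
      · have := congrArg Subtype.val h
        simpa [mul_assoc, inv_mul_eq_one] using this
      · simp [F, mul_assoc]
    have := Nat.card_le_card_of_surjective _ hsurj
    omega
  · push Not at hall
    obtain ⟨L, hL, hLM⟩ := hall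
    obtain ⟨hL1, hL2, hL3⟩ := hcard hL
    have hLG := L.card_mul_index
    have hsum : (Sum.elim (F M) (F L)).Injective := by
      refine (hFinj hM).sumElim (hFinj hL) fun y z h => hLM ((z.1.out)⁻¹ * y.1.out) ?_
      rw [map_mul, mul_smul, hF hM hL h, map_inv, inv_smul_smul]
    have := Nat.card_le_card_of_injective _ hsum
    rw [Nat.card_sum] at this
    nlinarith

theorem MetaNilHamiltonian.of_injective {G K : Type*} [Group G] [Group K] (f : K →* G)
    (hf : Function.Injective f) (hG : MetaNilHamiltonian G) : MetaNilHamiltonian K := by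
  intro H hH
  have : (H.map f).Normal := hG _ fun h => hH <|
    Group.nilpotent_of_mulEquiv (H.equivMapOfInjective f hf).symm
  rw [← H.comap_map_eq_self_of_injective hf]
  exact this.comap f

theorem Group.not_isNilpotent_comap {G K : Type*} [Group G] [Group K] {f : G →* K}
    (hf : Function.Surjective f) {H : Subgroup K} (hH : ¬ Group.IsNilpotent H) :
    ¬ Group.IsNilpotent (H.comap f) := fun _ =>
  hH (Group.nilpotent_of_surjective (f.subgroupComap H) (f.subgroupComap_surjective_of_surjective H hf))

theorem MetaNilHamiltonian.of_surjective {G K : Type*} [Group G] [Group K] (f : G →* K)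
    (hf : Function.Surjective f) (hG : MetaNilHamiltonian G) : MetaNilHamiltonian K := by
  intro H hH
  rw [← map_comap_eq_self_of_surjective hf H]
  exact (hG _ (Group.not_isNilpotent_comap hf hH)).map f hf

theorem MetaNilHamiltonian.isSolvable_of_finite {G : Type*} [Group G] [Finite G]
    (hG : MetaNilHamiltonian G) : Group.IsSolvable G := by
  induction hn : Nat.card G using Nat.strong_induction_on generalizing G with
  | _ n ih =>
  subst hn
  by_cases hs : ∃ N : Subgroup G, N.Normal ∧ N ≠ ⊥ ∧ N ≠ ⊤
  · obtain ⟨N, hN, hbot, htop⟩ := hs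
    refine (Group.isSolvable_iff_subgroup_quotient N).2
      ⟨ih _ ?_ (hG.of_injective N.subtype N.subtype_injective) rfl,
        ih _ ?_ (hG.of_surjective _ (QuotientGroup.mk'_surjective N)) rfl⟩
    · rw [← N.card_mul_index]
      exact lt_mul_of_one_lt_right Nat.card_pos (N.one_lt_index_of_ne_top htop)
    · rw [← N.index_mul_card]
      exact lt_mul_of_one_lt_right (Nat.pos_of_ne_zero N.index_ne_zero_of_finite)
        ((Subgroup.one_lt_card_iff_ne_bot N).2 hbot)
  · push Not at hs
    cases subsingleton_or_nontrivial G
    · infer_instance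
    have : IsSimpleGroup G := ⟨fun H hH => or_iff_not_imp_left.2 (hs H hH)⟩
    obtain hnil | hnil := Classical.em (Group.IsNilpotent G)
    · infer_instance
    refine IsSimpleGroup.isSolvable_of_forall_isNilpotent fun H hH => ?_
    by_contra hc
    obtain rfl | h := (hG H hc).eq_bot_or_eq_top
    · exact hc inferInstance
    · exact hH h

theorem Subgroup.isNilpotent_of_le {G : Type*} [Group G] {H K : Subgroup G} [Group.IsNilpotent K]
    (h : H ≤ K) : Group.IsNilpotent H :=
  Group.nilpotent_of_mulEquiv (subgroupOfEquivOfLe h)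

theorem MetaNilHamiltonian.commutator_inf_eq_bot {Q : Type*} [Group Q] [Finite Q]
    (hQ : MetaNilHamiltonian Q) (L : Subgroup Q) [L.Normal] {p : ℕ} [hp : Fact p.Prime]
    (hp2 : p ≠ 2) (hL : IsPGroup p L) (hind : ¬ p ∣ L.index)
    (hQL : ¬ Group.IsNilpotent (Q ⧸ L)) : commutator Q ⊓ L = ⊥ := by
  obtain ⟨n, hn⟩ := hL.exists_card_eq
  obtain ⟨H, hH⟩ := exists_right_complement'_of_coprime (N := L)
    (hn ▸ ((Nat.Prime.coprime_iff_not_dvd hp.out).2 hind).pow_left n)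
  have hHnil : ¬ Group.IsNilpotent H := fun _ =>
    hQL (Group.nilpotent_of_mulEquiv hH.symm.QuotientMulEquiv.symm)
  have hnorm : ∀ J : Subgroup Q, H ≤ J → J.Normal := fun J hJ => hQ J fun _ =>
    hHnil (isNilpotent_of_le hJ)
  have := hnorm H le_rfl
  have hpQ : IsPGroup p (Q ⧸ H) := IsPGroup.of_card (n := n) <| by
    rw [← hn]
    exact hH.index_eq_card
  have hcomm := hpQ.commute_of_forall_normal hp2 fun J => by
    rw [← map_comap_eq_self_of_surjective (QuotientGroup.mk'_surjective H) J]
    refine (hnorm _ ?_).map _ (QuotientGroup.mk'_surjective H)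
    exact (QuotientGroup.ker_mk' H).ge.trans (MonoidHom.ker_le_comap _ _)
  have hle : commutator Q ≤ H := Normal.quotient_commutative_iff_commutator_le.1 ⟨⟨hcomm⟩⟩
  exact eq_bot_iff.2 ((inf_le_inf_right L hle).trans hH.symm.disjoint.le_bot)

theorem MetaNilHamiltonian.commutator_inf_le {G : Type*} [Group G] (hG : MetaNilHamiltonian G)
    {K L : Subgroup G} [K.Normal] [K.FiniteIndex] [L.Normal] (hKL : K ≤ L) {p : ℕ}
    [Fact p.Prime] (hp2 : p ≠ 2) (hL : ∀ l ∈ L, ∃ k, l ^ p ^ k ∈ K) (hind : ¬ p ∣ L.index)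
    (hGL : ¬ Group.IsNilpotent (G ⧸ L)) : commutator G ⊓ L ≤ K := by
  rintro x ⟨hx, hxL⟩
  have hLn : (L.map (QuotientGroup.mk' K)).Normal :=
    Normal.map inferInstance _ (QuotientGroup.mk'_surjective K)
  have hbot := (hG.of_surjective _ (QuotientGroup.mk'_surjective K)).commutator_inf_eq_bot
    (L.map (QuotientGroup.mk' K)) hp2 ?_ ?_ ?_
  · have hmem : QuotientGroup.mk' K x ∈ commutator (G ⧸ K) ⊓ L.map (QuotientGroup.mk' K) := by
      refine ⟨?_, mem_map_of_mem _ hxL⟩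
      have := mem_map_of_mem (QuotientGroup.mk' K) hx
      rw [commutator_def, map_commutator] at this
      exact commutator_mono le_top le_top this
    rwa [hbot, mem_bot, QuotientGroup.mk'_apply, QuotientGroup.eq_one_iff] at hmem
  · rintro ⟨_, l, hl, rfl⟩
    obtain ⟨k, hk⟩ := hL l hl
    refine ⟨k, Subtype.ext ?_⟩
    rwa [SubgroupClass.coe_pow, ← map_pow, OneMemClass.coe_one, QuotientGroup.mk'_apply,
      QuotientGroup.eq_one_iff]
  · exact fun h => hind (h.trans (L.index_map_dvd (QuotientGroup.mk'_surjective K)))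
  · exact fun _ => hGL (Group.nilpotent_of_mulEquiv
      (QuotientGroup.quotientQuotientEquivQuotient K L hKL))

/-- The subgroup of elements that are `n`-th powers modulo the commutator subgroup. -/
def Subgroup.powModCommutator (D : Type*) [Group D] (n : ℕ) : Subgroup D :=
  (powMonoidHom n : Abelianization D →* Abelianization D).range.comap Abelianization.of

instance Subgroup.powModCommutator_characteristic (D : Type*) [Group D] (n : ℕ) :
    (powModCommutator D n).Characteristic := by
  refine characteristic_iff_le_comap.2 fun φ x hx => ?_
  obtain ⟨a, ha⟩ := hx
  refine ⟨Abelianization.map φ.toMonoidHom a, ?_⟩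
  rw [powMonoidHom_apply] at ha ⊢
  rw [← map_pow, ha]
  rfl

theorem Subgroup.pow_mem_powModCommutator {D : Type*} [Group D] (n : ℕ) (x : D) :
    x ^ n ∈ powModCommutator D n :=
  ⟨Abelianization.of x, (map_pow _ _ _).symm⟩

theorem Subgroup.powModCommutator_ne_top {D : Type*} [Group D] [Group.FG D] [Infinite D]
    [Finite (_root_.commutator D)] {p : ℕ} (hp : p.Prime) : powModCommutator D p ≠ ⊤ := by
  intro htop
  have hdiv : ∀ a : Abelianization D, ∃ b, b ^ p = a := fun a => by
    obtain ⟨x, rfl⟩ := QuotientGroup.mk_surjective a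
    exact (htop ▸ mem_top x : x ∈ powModCommutator D p)
  have hdiv' : ∀ k, ∀ a : Abelianization D, ∃ b, b ^ p ^ k = a := by
    intro k
    induction k with
    | zero => exact fun a => ⟨a, by simp⟩
    | succ k ih =>
      intro a
      obtain ⟨b, rfl⟩ := ih a
      obtain ⟨c, rfl⟩ := hdiv b
      exact ⟨c, by rw [pow_succ', pow_mul]⟩
  have : Group.FG (Abelianization D) :=
    Group.fg_of_surjective (f := Abelianization.of) QuotientGroup.mk_surjective
  have hfin : Finite (Abelianization D) := IsMulCommutative.finite_of_fg fun a =>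
    isOfFinOrder_iff_pow_eq_one.1
      (CommGroup.mem_torsion_of_forall_mem_range_pow hp fun k => hdiv' k a)
  have : Finite (D ⧸ _root_.commutator D) := hfin
  have := Finite.of_equiv _ (groupEquivQuotientProdSubgroup (s := _root_.commutator D)).symm
  exact not_finite D

theorem Subgroup.exists_normal_le_finite_commutator {G : Type*} [Group G] (S : Subgroup G)
    [S.Normal] [Infinite S] [hS : Group.IsSolvable S] :
    ∃ D ≤ S, D.Normal ∧ Infinite D ∧ Finite (_root_.commutator D) := by
  classical
  obtain ⟨n, hn⟩ := hS.solvable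
  have hex : ∃ n, Finite (derivedSeries S n) := ⟨n, by rw [hn]; infer_instance⟩
  have hmin := fun m => Nat.find_min hex (m := m)
  have hfin := Nat.find_spec hex
  obtain h0 | ⟨i, hi⟩ := (Classical.em (Nat.find hex = 0)).imp_right
    Nat.exists_eq_add_one_of_ne_zero
  · rw [h0, derivedSeries_zero] at hfin
    have : Finite S := Finite.of_equiv _ topEquiv.toEquiv
    exact (not_finite S).elim
  · rw [hi, derivedSeries_succ] at hfin
    have hinf := hmin i (by omega)
    rw [not_finite_iff_infinite] at hinf
    refine ⟨(derivedSeries S i).map S.subtype, map_subtype_le _, inferInstance, ?_, ?_⟩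
    · exact ((derivedSeries S i).equivMapOfInjective _
        S.subtype_injective).toEquiv.infinite_iff.1 hinf
    · set D := (derivedSeries S i).map S.subtype with hD
      have h : (_root_.commutator D).map D.subtype =
          ⁅derivedSeries S i, derivedSeries S i⁆.map S.subtype := by
        rw [map_subtype_commutator, map_commutator]
      have hfin' : Finite ((_root_.commutator D).map D.subtype) := by
        rw [h]
        exact Finite.of_equiv _ (equivMapOfInjective _ _ S.subtype_injective).toEquiv
      exact Finite.of_equiv _ (equivMapOfInjective _ _ D.subtype_injective).symm.toEquiv

theorem MetaNilHamiltonian.finite_commutator {G : Type*} [Group G] [WellFoundedGT (Subgroup G)]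
    (hG : MetaNilHamiltonian G) (L : Subgroup G) [L.Normal] [L.FiniteIndex] [Group.IsNilpotent L]
    (hGL : ¬ Group.IsNilpotent (G ⧸ L)) : Finite (commutator G) := by
  by_contra hinf
  have hS : ¬ Finite (commutator G ⊓ L : Subgroup G) := by
    intro h
    have : Finite (L.subgroupOf (commutator G)) := by
      have := Finite.of_injective (β := (commutator G ⊓ L : Subgroup G))
        (fun x : L.subgroupOf (commutator G) => ⟨x.1.1, x.1.2, x.2⟩)
        fun x y h => Subtype.ext (Subtype.ext (Subtype.mk.inj h))
      exact this
    exact hinf (Finite.of_equiv _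
      (groupEquivQuotientProdSubgroup (s := L.subgroupOf (commutator G))).symm)
  rw [not_finite_iff_infinite] at hS
  have : Group.IsSolvable (commutator G ⊓ L : Subgroup G) :=
    Group.isSolvable_of_isSolvable_injective (inclusion_injective inf_le_right)
  obtain ⟨D, hDS, hDn, hDinf, hDfin⟩ := exists_normal_le_finite_commutator (commutator G ⊓ L)
  obtain ⟨p, hpl, hp⟩ := Nat.exists_infinite_primes (L.index + 3)
  have := Fact.mk hp
  have hind : ¬ p ∣ L.index := fun h =>
    absurd (Nat.le_of_dvd (Nat.pos_of_ne_zero FiniteIndex.index_ne_zero) h) (by omega)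
  obtain ⟨x, hx⟩ := SetLike.exists_not_mem_of_ne_top _ (powModCommutator_ne_top (D := D) hp) rfl
  set T := (powModCommutator D p).map D.subtype with hT
  have hTn : T.Normal := inferInstance
  have hxL : (x : G) ∈ L := (hDS x.2).2
  have hxT : (⟨x, hxL⟩ : L) ∉ T.subgroupOf L := by
    rintro ⟨y, hy, hyx⟩
    rw [show y = x from Subtype.ext hyx] at hy
    exact hx hy
  have hxpT : (⟨x, hxL⟩ : L) ^ p ∈ T.subgroupOf L :=
    ⟨x ^ p, pow_mem_powModCommutator p x, rfl⟩
  obtain ⟨N, hN, -, hxN, hfin, hpN⟩ := Group.IsNilpotent.exists_normal_isPGroup_quotient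
    (T.subgroupOf L) hxT hxpT
  obtain ⟨n, hn⟩ := hpN.exists_card_eq
  have : N.FiniteIndex := finiteIndex_of_finite_quotient
  have : (N.map L.subtype).FiniteIndex :=
    ⟨index_map_subtype N ▸ mul_ne_zero FiniteIndex.index_ne_zero FiniteIndex.index_ne_zero⟩
  have hle := hG.commutator_inf_le (K := (N.map L.subtype).normalCore)
    ((normalCore_le _).trans (map_subtype_le N)) (by omega : p ≠ 2) ?_ hind hGL
  · obtain ⟨y, hy, hyx⟩ := normalCore_le _ (hle (hDS x.2))
    rw [show y = ⟨x, hxL⟩ from Subtype.ext hyx] at hy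
    exact hxN hy
  · intro l hl
    refine ⟨n, fun b => ?_⟩
    have hb : b * l * b⁻¹ ∈ L := Normal.conj_mem inferInstance l hl b
    refine ⟨⟨_, hb⟩ ^ p ^ n, ?_, ?_⟩
    · rw [← hn]
      exact N.pow_index_mem _
    · simp [conj_pow]

end

/-- A finitely generated non-nilpotent meta-Nil-Hamiltonian group with a nilpotent
subgroup of finite index is soluble and has finite commutator subgroup. -/
theorem stmt_19 {G : Type*} [Group G] (hfg : Group.FG G) (hnn : ¬ Group.IsNilpotent G)
    (hmeta : MetaNilHamiltonian G) (H : Subgroup G) (hidx : H.FiniteIndex)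
    (hnil : Group.IsNilpotent H) :
    IsSolvable G ∧ Finite (commutator G) := by
  set L₀ := H.normalCore
  have hL₀ : Group.IsNilpotent L₀ := Subgroup.isNilpotent_of_le H.normalCore_le
  have : Group.FG L₀ := inferInstance
  have := Group.wellFoundedGT_subgroup_of_fg_of_isNilpotent L₀
  have := wellFoundedGT_subgroup_of_extension L₀
  refine ⟨(Group.isSolvable_iff_subgroup_quotient L₀).2 ⟨inferInstance,
    (hmeta.of_surjective _ (QuotientGroup.mk'_surjective L₀)).isSolvable_of_finite⟩, ?_⟩
  obtain ⟨M, hM, hMfi, hGM⟩ := Group.exists_finiteIndex_quotient_not_isNilpotent hnn L₀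
  have : Group.IsNilpotent (L₀ ⊓ M : Subgroup G) :=
    Subgroup.isNilpotent_of_le inf_le_left
  refine hmeta.finite_commutator (L₀ ⊓ M) fun _ => hGM ?_
  refine Group.nilpotent_of_surjective (QuotientGroup.map (L₀ ⊓ M) M (MonoidHom.id G) ?_) ?_
  · exact inf_le_right
  · exact QuotientGroup.map_surjective_of_surjective _ _ _ QuotientGroup.mk_surjective _
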